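/- Let Q be a quasivariety, A, B ∈ Q, φ : A → B a surjective homomorphism, and R ⊆ A×A. Then φ⁻¹[Cg_Q^B(φ[R])] = Cg_Q^A(R) ∨ ker φ, where φ[R] := {(φ(x),φ(y)) : (x,y) ∈ R}, φ⁻¹[Ψ] := {(x,y) ∈ A×A : (φ(x),φ(y)) ∈ Ψ}, and the join on the right-hand side is taken in Con_Q A. -/

import Mathlib

open FirstOrder Language Set

universe u

namespace Transfer

variable (L : FirstOrder.Language.{u, u})

/-- A bundled `L`-structure with carrier in universe `u`. -/
structure Struc : Type (u + 1) where
  Carrier : Type u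
  [str : L.Structure Carrier]

attribute [instance] Struc.str

/-- Product structure on a Pi type. -/
instance piStructure {ι : Type u} (M : ι → Type u) [∀ i, L.Structure (M i)] :
    L.Structure (∀ i, M i) where
  funMap f x i := Structure.funMap f fun j => x j i
  RelMap r x := ∀ i, Structure.RelMap r fun j => x j i

/-- Product structure on a binary product. -/
instance prodStructure (M N : Type u) [L.Structure M] [L.Structure N] :
    L.Structure (M × N) where
  funMap f x := (Structure.funMap f fun j => (x j).1, Structure.funMap f fun j => (x j).2)
  RelMap r x := Structure.RelMap r (fun j => (x j).1) ∧ Structure.RelMap r (fun j => (x j).2)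

variable {L}

/-- The bundled structure on a substructure. -/
abbrev ofSub (B : Struc L) (S : L.Substructure B.Carrier) : Struc L := ⟨S⟩

/-- The kernel of a map, as a set of pairs. -/
def kerSet {α β : Type u} (f : α → β) : Set (α × α) := {p | f p.1 = f p.2}

/-- The restriction of a binary relation on `B` to a substructure `S`. -/
def restrict {B : Struc L} (S : L.Substructure B.Carrier)
    (Θ : Set (B.Carrier × B.Carrier)) : Set ((ofSub B S).Carrier × (ofSub B S).Carrier) :=
  {p | ((p.1 : B.Carrier), (p.2 : B.Carrier)) ∈ Θ}

/-- The image of a binary relation on a substructure `S` in `B`. -/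
def lift {B : Struc L} (S : L.Substructure B.Carrier)
    (Θ : Set ((ofSub B S).Carrier × (ofSub B S).Carrier)) : Set (B.Carrier × B.Carrier) :=
  (fun p => ((p.1 : B.Carrier), (p.2 : B.Carrier))) '' Θ

/-- The set of `Q`-congruences of `A`: kernels of homomorphisms into members of `Q`. -/
def ConQ (Q : Set (Struc L)) (A : Struc L) : Set (Set (A.Carrier × A.Carrier)) :=
  {θ | ∃ M ∈ Q, ∃ f : A.Carrier →[L] M.Carrier, θ = kerSet f}

/-- The least `Q`-congruence of `A` containing `R`. -/
def cgQ (Q : Set (Struc L)) (A : Struc L) (R : Set (A.Carrier × A.Carrier)) :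
    Set (A.Carrier × A.Carrier) :=
  ⋂₀ {θ | θ ∈ ConQ Q A ∧ R ⊆ θ}

/-- The join of two `Q`-congruences in `Con_Q A`. -/
def joinQ (Q : Set (Struc L)) (A : Struc L) (θ φ : Set (A.Carrier × A.Carrier)) :
    Set (A.Carrier × A.Carrier) :=
  cgQ Q A (θ ∪ φ)

/-- `θ` is a meet-irreducible element of `Con_Q A`. -/
def MeetIrred (Q : Set (Struc L)) (A : Struc L) (θ : Set (A.Carrier × A.Carrier)) : Prop :=
  θ ∈ ConQ Q A ∧
    ∀ θ₁ ∈ ConQ Q A, ∀ θ₂ ∈ ConQ Q A, θ = θ₁ ∩ θ₂ → θ = θ₁ ∨ θ = θ₂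

/-- `θ` is a completely meet-irreducible element of `Con_Q A`. -/
def CompletelyMeetIrred (Q : Set (Struc L)) (A : Struc L)
    (θ : Set (A.Carrier × A.Carrier)) : Prop :=
  θ ∈ ConQ Q A ∧
    ∀ S ⊆ ConQ Q A, θ = ⋂₀ S → θ ∈ S

/-- The class of relatively finitely subdirectly irreducible members of `Q`. -/
def RFSI (Q : Set (Struc L)) : Set (Struc L) :=
  {A | A ∈ Q ∧ MeetIrred Q A (Set.diagonal A.Carrier)}

/-- The class of relatively subdirectly irreducible members of `Q`. -/
def RSI (Q : Set (Struc L)) : Set (Struc L) :=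
  {A | A ∈ Q ∧ CompletelyMeetIrred Q A (Set.diagonal A.Carrier)}

/-- `B` has the `Q`-congruence extension property. -/
def HasQCEP (Q : Set (Struc L)) (B : Struc L) : Prop :=
  ∀ S : L.Substructure B.Carrier, ∀ θ ∈ ConQ Q (ofSub B S),
    ∃ Φ ∈ ConQ Q B, restrict S Φ = θ

/-- A class `K` of members of `Q` has the `Q`-congruence extension property. -/
def ClassQCEP (Q K : Set (Struc L)) : Prop :=
  ∀ B ∈ K, HasQCEP Q B

variable (L)

/-- `Q` is a quasivariety: closed under isomorphisms, substructures, direct products,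
and ultraproducts. -/
def IsQuasivariety (Q : Set (Struc L)) : Prop :=
  (∀ A ∈ Q, ∀ B : Struc L, Nonempty (A.Carrier ≃[L] B.Carrier) → B ∈ Q) ∧
  (∀ B ∈ Q, ∀ S : L.Substructure B.Carrier, ofSub B S ∈ Q) ∧
  (∀ (ι : Type u) (f : ι → Struc L), (∀ i, f i ∈ Q) →
    (⟨∀ i, (f i).Carrier⟩ : Struc L) ∈ Q) ∧
  (∀ (ι : Type u) (f : ι → Struc L) (U : Ultrafilter ι), (∀ i, f i ∈ Q) →
    (⟨(U : Filter ι).Product fun i => (f i).Carrier⟩ : Struc L) ∈ Q)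

/-- `V` is a variety: closed under homomorphic images, substructures, and direct products. -/
def IsVariety (V : Set (Struc L)) : Prop :=
  (∀ A ∈ V, ∀ B : Struc L, ∀ f : A.Carrier →[L] B.Carrier, Function.Surjective f → B ∈ V) ∧
  (∀ B ∈ V, ∀ S : L.Substructure B.Carrier, ofSub B S ∈ V) ∧
  (∀ (ι : Type u) (f : ι → Struc L), (∀ i, f i ∈ V) →
    (⟨∀ i, (f i).Carrier⟩ : Struc L) ∈ V)

variable {L}

/-- `Q` is relatively congruence-distributive: `Con_Q A` is a distributive lattice
for every `A ∈ Q`. -/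
def RelCongDist (Q : Set (Struc L)) : Prop :=
  ∀ A ∈ Q, ∀ θ ∈ ConQ Q A, ∀ φ ∈ ConQ Q A, ∀ ψ ∈ ConQ Q A,
    θ ∩ joinQ Q A φ ψ = joinQ Q A (θ ∩ φ) (θ ∩ ψ)

/-- Relation composition `Θ ∘ Φ = {(a,c) : ∃ b, (a,b) ∈ Φ ∧ (b,c) ∈ Θ}`. -/
def relComp {α : Type u} (Θ Φ : Set (α × α)) : Set (α × α) :=
  {p | ∃ b, (p.1, b) ∈ Φ ∧ (b, p.2) ∈ Θ}

/-- `Q` is relatively congruence-permutable. -/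
def RelCongPerm (Q : Set (Struc L)) : Prop :=
  ∀ A ∈ Q, ∀ θ ∈ ConQ Q A, ∀ φ ∈ ConQ Q A, relComp θ φ = relComp φ θ

/-- A class `K` is closed under substructures. -/
def SubClosed (K : Set (Struc L)) : Prop :=
  ∀ B ∈ K, ∀ S : L.Substructure B.Carrier, ofSub B S ∈ K

/-- A class `K` is closed under isomorphisms. -/
def IsoClosed (K : Set (Struc L)) : Prop :=
  ∀ A ∈ K, ∀ B : Struc L, Nonempty (A.Carrier ≃[L] B.Carrier) → B ∈ K

/-- A universal class: closed under isomorphisms, substructures, and ultraproducts. -/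
def IsUniversalClass (K : Set (Struc L)) : Prop :=
  IsoClosed K ∧ SubClosed K ∧
  (∀ (ι : Type u) (f : ι → Struc L) (U : Ultrafilter ι), (∀ i, f i ∈ K) →
    (⟨(U : Filter ι).Product fun i => (f i).Carrier⟩ : Struc L) ∈ K)

/-- The extension property for a class `K`. -/
def HasEP (K : Set (Struc L)) : Prop :=
  ∀ A ∈ K, ∀ B ∈ K, ∀ C ∈ K,
    ∀ (φB : A.Carrier →[L] B.Carrier) (φC : A.Carrier →[L] C.Carrier),
      Function.Injective φB → Function.Surjective φC →
      ∃ D ∈ K, ∃ (ψB : B.Carrier →[L] D.Carrier) (ψC : C.Carrier →[L] D.Carrier),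
        Function.Injective ψC ∧ ∀ a, ψB (φB a) = ψC (φC a)

/-- The one-sided amalgamation property for a class `K`. -/
def Has1AP (K : Set (Struc L)) : Prop :=
  ∀ A ∈ K, ∀ B ∈ K, ∀ C ∈ K,
    ∀ (φB : A.Carrier →[L] B.Carrier) (φC : A.Carrier →[L] C.Carrier),
      Function.Injective φB → Function.Injective φC →
      ∃ D ∈ K, ∃ (ψB : B.Carrier →[L] D.Carrier) (ψC : C.Carrier →[L] D.Carrier),
        Function.Injective ψC ∧ ∀ a, ψB (φB a) = ψC (φC a)

/-- Every doubly injective span in `K` has an amalgam in `K'`. -/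
def HasAmalgamIn (K K' : Set (Struc L)) : Prop :=
  ∀ A ∈ K, ∀ B ∈ K, ∀ C ∈ K,
    ∀ (φB : A.Carrier →[L] B.Carrier) (φC : A.Carrier →[L] C.Carrier),
      Function.Injective φB → Function.Injective φC →
      ∃ D ∈ K', ∃ (ψB : B.Carrier →[L] D.Carrier) (ψC : C.Carrier →[L] D.Carrier),
        Function.Injective ψB ∧ Function.Injective ψC ∧ ∀ a, ψB (φB a) = ψC (φC a)

/-- The amalgamation property for a class `K`. -/
def HasAP (K : Set (Struc L)) : Prop := HasAmalgamIn K K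

/-- The transferable injections property for a class `K`. -/
def HasTIP (K : Set (Struc L)) : Prop :=
  ∀ A ∈ K, ∀ B ∈ K, ∀ C ∈ K,
    ∀ (φB : A.Carrier →[L] B.Carrier) (φC : A.Carrier →[L] C.Carrier),
      Function.Injective φB →
      ∃ D ∈ K, ∃ (ψB : B.Carrier →[L] D.Carrier) (ψC : C.Carrier →[L] D.Carrier),
        Function.Injective ψC ∧ ∀ a, ψB (φB a) = ψC (φC a)

/-- Every doubly injective span in `K` has a strong amalgam in `K'`. -/
def HasStrongAmalgamIn (K K' : Set (Struc L)) : Prop :=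
  ∀ A ∈ K, ∀ B ∈ K, ∀ C ∈ K,
    ∀ (φB : A.Carrier →[L] B.Carrier) (φC : A.Carrier →[L] C.Carrier),
      Function.Injective φB → Function.Injective φC →
      ∃ D ∈ K', ∃ (ψB : B.Carrier →[L] D.Carrier) (ψC : C.Carrier →[L] D.Carrier),
        Function.Injective ψB ∧ Function.Injective ψC ∧ (∀ a, ψB (φB a) = ψC (φC a)) ∧
        Set.range (fun a => ψB (φB a)) = Set.range ψB ∩ Set.range ψC

/-- The strong amalgamation property for a class `K`. -/
def HasSAP (K : Set (Struc L)) : Prop := HasStrongAmalgamIn K K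

/-- `φ : A → B` is an epimorphism in the class `K`. -/
def IsEpiIn (K : Set (Struc L)) {A B : Struc L} (φ : A.Carrier →[L] B.Carrier) : Prop :=
  ∀ C ∈ K, ∀ ψ₁ ψ₂ : B.Carrier →[L] C.Carrier,
    ψ₁.comp φ = ψ₂.comp φ → ψ₁ = ψ₂

/-- The class `K` has surjective epimorphisms. -/
def HasSE (K : Set (Struc L)) : Prop :=
  ∀ A ∈ K, ∀ B ∈ K, ∀ φ : A.Carrier →[L] B.Carrier,
    IsEpiIn K φ → Function.Surjective φ

/-- A substructure `S` of `B` is a retract of `B`. -/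
def IsRetract (B : Struc L) (S : L.Substructure B.Carrier) : Prop :=
  ∃ ψ : B.Carrier →[L] (ofSub B S).Carrier, ∀ a : (ofSub B S).Carrier, ψ (a : B.Carrier) = a


/-- The smallest variety containing `V₁ ∪ V₂`. -/
def varJoin (L : FirstOrder.Language.{u, u}) (V₁ V₂ : Set (Struc L)) : Set (Struc L) :=
  ⋂₀ {W | IsVariety L W ∧ V₁ ⊆ W ∧ V₂ ⊆ W}

/-- A homomorphism out of `A` whose kernel contains the kernel of a surjective homomorphism
`φ : A → B` factors through `φ`. -/
theorem exists_hom_comp_eq [L.IsAlgebraic] {A B M : Type u} [L.Structure A] [L.Structure B]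
    [L.Structure M] (φ : A →[L] B) (hφ : Function.Surjective φ) (f : A →[L] M)
    (h : kerSet φ ⊆ kerSet f) : ∃ g : B →[L] M, ∀ a, g (φ a) = f a := by
  have hfactor : ∀ a, f (Function.surjInv hφ (φ a)) = f a := fun a =>
    h (show (Function.surjInv hφ (φ a), a) ∈ kerSet φ from Function.surjInv_eq hφ (φ a))
  refine ⟨⟨fun b => f (Function.surjInv hφ b), fun {n} F x => ?_, fun {n} r => isEmptyElim r⟩,
    hfactor⟩
  obtain ⟨y, rfl⟩ : ∃ y : Fin n → A, φ ∘ y = x :=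
    ⟨fun i => Function.surjInv hφ (x i), funext fun i => Function.surjInv_eq hφ (x i)⟩
  rw [← φ.map_fun, hfactor, f.map_fun]
  exact congrArg _ (funext fun i => (hfactor (y i)).symm)

theorem cgQ_subset {Q : Set (Struc L)} {A : Struc L} {R θ : Set (A.Carrier × A.Carrier)}
    (hθ : θ ∈ ConQ Q A) (hR : R ⊆ θ) : cgQ Q A R ⊆ θ :=
  Set.sInter_subset_of_mem ⟨hθ, hR⟩

theorem subset_cgQ (Q : Set (Struc L)) (A : Struc L) (R : Set (A.Carrier × A.Carrier)) :
    R ⊆ cgQ Q A R :=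
  Set.subset_sInter fun _ hθ => hθ.2

/-- Lemma 2.2: for a surjective homomorphism `φ : A → B` between members of `Q`
and `R ⊆ A×A`, `φ⁻¹[Cg_Q^B(φ[R])] = Cg_Q^A(R) ∨ ker φ`. -/
theorem stmt2 (L : FirstOrder.Language.{u, u}) [L.IsAlgebraic]
    (Q : Set (Struc L)) (hQ : IsQuasivariety L Q) (A B : Struc L)
    (hA : A ∈ Q) (hB : B ∈ Q)
    (φ : A.Carrier →[L] B.Carrier) (hφ : Function.Surjective φ)
    (R : Set (A.Carrier × A.Carrier)) :
    Prod.map (⇑φ) (⇑φ) ⁻¹' cgQ Q B (Prod.map (⇑φ) (⇑φ) '' R)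
      = joinQ Q A (cgQ Q A R) (kerSet ⇑φ) := by
  apply Set.Subset.antisymm
  · rintro p hp _ ⟨⟨M, hM, f, rfl⟩, hf⟩
    obtain ⟨g, hg⟩ := exists_hom_comp_eq φ hφ f (Set.subset_union_right.trans hf)
    have hR : Prod.map φ φ '' R ⊆ kerSet g := by
      rintro _ ⟨q, hq, rfl⟩
      change g (φ q.1) = g (φ q.2)
      rw [hg, hg]
      exact hf (Or.inl (subset_cgQ Q A R hq))
    have hp' : g (φ p.1) = g (φ p.2) := cgQ_subset ⟨M, hM, g, rfl⟩ hR hp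
    rwa [hg, hg] at hp'
  · rintro p hp _ ⟨⟨M, hM, g, rfl⟩, hg⟩
    have hcon : kerSet (g.comp φ) ∈ ConQ Q A := ⟨M, hM, g.comp φ, rfl⟩
    exact cgQ_subset hcon (Set.union_subset
      (cgQ_subset hcon fun q hq => hg (Set.mem_image_of_mem _ hq))
      fun q hq => congrArg g hq) hp

end Transfer
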